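/- Let N ≥ 3, K(y) = exp(|y|²/4), 2* = 2N/(N−2), p = 2*−1, β = (N−2)/4, μ ∈ [0, (N−2)²/8]. Suppose v₀ ∈ X satisfies (8(p+1)/(p−1)) E_K(v₀) ≤ ‖v₀‖²_{K,2} < ((p−1)/(2(p+1))) ‖v₀‖^{p+1}_{K,p+1}. Then D_K(v₀) < 0 (i.e. v₀ ∈ 𝒩₋), and moreover every v ∈ 𝒩 with E_K(v) < E_K(v₀) satisfies ‖v‖_{K,2} ≤ ‖v₀‖_{K,2}; in particular ‖v₀‖_{K,2} ≥ Λ_{E_K(v₀)} := sup{ ‖v‖_{K,2} : v ∈ 𝒩, E_K(v) < E_K(v₀) }. -/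

import Mathlib

open MeasureTheory Real Set

noncomputable section

abbrev Euc (N : ℕ) := EuclideanSpace ℝ (Fin N)

def Kw {N : ℕ} (x : Euc N) : ℝ := Real.exp (‖x‖ ^ 2 / 4)

def twoStar (N : ℕ) : ℝ := 2 * N / ((N : ℝ) - 2)

structure MemX {N : ℕ} (v : Euc N → ℝ) : Prop where
  diff : Differentiable ℝ v
  int_grad : Integrable fun x => ‖gradient v x‖ ^ 2 * Kw x
  int_sq : Integrable fun x => v x ^ 2 * Kw x
  int_hardy : Integrable fun x => v x ^ 2 / ‖x‖ ^ 2 * Kw x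
  int_crit : Integrable fun x => |v x| ^ twoStar N * Kw x

def Afun {N : ℕ} (μ : ℝ) (v : Euc N → ℝ) : ℝ :=
  ∫ x, (‖gradient v x‖ ^ 2 - μ * v x ^ 2 / ‖x‖ ^ 2 - ((N : ℝ) - 2) / 4 * v x ^ 2) * Kw x

def Bfun {N : ℕ} (v : Euc N → ℝ) : ℝ := ∫ x, |v x| ^ twoStar N * Kw x

def EKf {N : ℕ} (μ : ℝ) (v : Euc N → ℝ) : ℝ := Afun μ v / 2 - Bfun v / twoStar N

def DK {N : ℕ} (μ : ℝ) (v : Euc N → ℝ) : ℝ := Afun μ v - Bfun v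

def DKd {N : ℕ} (μ δ : ℝ) (v : Euc N → ℝ) : ℝ := δ * Afun μ v - Bfun v

def normKp1Sq {N : ℕ} (v : Euc N → ℝ) : ℝ := Bfun v ^ (2 / twoStar N)

def SK (N : ℕ) (μ : ℝ) : ℝ :=
  sInf { r | ∃ v : Euc N → ℝ, MemX v ∧ v ≠ 0 ∧ r = Afun μ v / normKp1Sq v }

def rdel (N : ℕ) (μ δ : ℝ) : ℝ := δ ^ (((N : ℝ) - 2) / 2) * SK N μ ^ ((N : ℝ) / 2)

def gradNormSq {N : ℕ} (v : Euc N → ℝ) : ℝ := ∫ x, ‖gradient v x‖ ^ 2 * Kw x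

def normKsq {N : ℕ} (v : Euc N → ℝ) : ℝ := ∫ x, v x ^ 2 * Kw x

def ddepth (N : ℕ) (μ δ : ℝ) : ℝ :=
  sInf { e | ∃ v : Euc N → ℝ, MemX v ∧ DKd μ δ v = 0 ∧ gradNormSq v ≠ 0 ∧ e = EKf μ v }

def dwell (N : ℕ) (μ : ℝ) : ℝ :=
  sInf { e | ∃ v : Euc N → ℝ, MemX v ∧ v ≠ 0 ∧ DK μ v = 0 ∧ e = EKf μ v }

theorem Kw_pos {N : ℕ} (x : Euc N) : 0 < Kw x := Real.exp_pos _

theorem continuous_Kw {N : ℕ} : Continuous (Kw : Euc N → ℝ) := by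
  unfold Kw; fun_prop

theorem fderiv_single_eq_gradient_apply {N : ℕ} {v : Euc N → ℝ} (x : Euc N) (i : Fin N) :
    fderiv ℝ v x (EuclideanSpace.single i 1) = gradient v x i := by
  rw [← toDual_gradient, InnerProductSpace.toDual_apply_apply, EuclideanSpace.inner_single_right]
  simp

theorem measurable_gradient_apply {N : ℕ} (v : Euc N → ℝ) (i : Fin N) :
    Measurable fun x => gradient v x i := by
  simp_rw [← fderiv_single_eq_gradient_apply]
  exact measurable_fderiv_apply_const ℝ v _

theorem hasLineDerivAt_norm_sq_single {N : ℕ} (x : Euc N) (i : Fin N) :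
    HasLineDerivAt ℝ (fun y : Euc N => ‖y‖ ^ 2) (2 * x i) x (EuclideanSpace.single i 1) := by
  refine HasDerivAt.congr_deriv ((hasStrictFDerivAt_norm_sq x).hasFDerivAt.hasLineDerivAt
    (EuclideanSpace.single i 1)) ?_
  simp [EuclideanSpace.inner_single_right]

theorem hasLineDerivAt_apply_single {N : ℕ} (x : Euc N) (i : Fin N) :
    HasLineDerivAt ℝ (fun y : Euc N => y i) 1 x (EuclideanSpace.single i 1) := by
  refine HasDerivAt.congr_deriv ((EuclideanSpace.proj (𝕜 := ℝ) i).hasFDerivAt.hasLineDerivAt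
    (x := x) (EuclideanSpace.single i 1)) ?_
  simp

/-- The `i`-th partial derivative of the `i`-th component of the field `K(x) φ(|x|²) x`. -/
theorem hasLineDerivAt_weighted_radial_field {N : ℕ} {φ φ' : ℝ → ℝ}
    (hφ : ∀ s, 0 ≤ s → HasDerivAt φ (φ' s) s) (x : Euc N) (i : Fin N) :
    HasLineDerivAt ℝ (fun y : Euc N => φ (‖y‖ ^ 2) * y i * Kw y)
      ((φ (‖x‖ ^ 2) + 2 * φ' (‖x‖ ^ 2) * x i ^ 2 + φ (‖x‖ ^ 2) * x i ^ 2 / 2) * Kw x)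
      x (EuclideanSpace.single i 1) := by
  have hs := hasLineDerivAt_norm_sq_single x i
  have hc := hasLineDerivAt_apply_single x i
  unfold HasLineDerivAt at hs hc ⊢
  have h1 : HasDerivAt (fun t : ℝ => φ (‖x + t • EuclideanSpace.single i (1 : ℝ)‖ ^ 2))
      (φ' (‖x‖ ^ 2) * (2 * x i)) 0 :=
    HasDerivAt.comp_of_eq 0 (hφ (‖x‖ ^ 2) (by positivity)) hs (by simp)
  have h2 := (hs.div_const 4).exp
  have h3 := (h1.mul hc).mul h2
  refine h3.congr_deriv ?_
  simp only [Kw, Pi.mul_apply, zero_smul, add_zero]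
  ring

theorem sq_apply_le_norm_sq {N : ℕ} (x : Euc N) (i : Fin N) : x i ^ 2 ≤ ‖x‖ ^ 2 := by
  rw [EuclideanSpace.real_norm_sq_eq]
  exact Finset.single_le_sum (f := fun j => x j ^ 2) (fun j _ => sq_nonneg _) (Finset.mem_univ i)

/-- A continuous radial profile, decaying like `1/s` in the sense needed to test the weighted
Hardy inequality. -/
structure AdmissibleProfile (φ φ' : ℝ → ℝ) (C : ℝ) : Prop where
  hasDerivAt : ∀ s, 0 ≤ s → HasDerivAt φ (φ' s) s
  continuousOn_deriv : ContinuousOn φ' (Ici 0)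
  abs_le : ∀ s, 0 ≤ s → |φ s| ≤ C
  mul_abs_le : ∀ s, 0 ≤ s → s * |φ s| ≤ C
  mul_abs_deriv_le : ∀ s, 0 ≤ s → s * |φ' s| ≤ C

namespace AdmissibleProfile

variable {N : ℕ} {φ φ' : ℝ → ℝ} {C : ℝ}

theorem continuous_comp (h : AdmissibleProfile φ φ' C) :
    Continuous fun x : Euc N => φ (‖x‖ ^ 2) := by
  have hc : ContinuousOn φ (Ici 0) := fun s hs => (h.hasDerivAt s hs).continuousAt.continuousWithinAt
  exact hc.comp_continuous (by fun_prop) fun x => mem_Ici.mpr (sq_nonneg _)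

theorem continuous_deriv_comp (h : AdmissibleProfile φ φ' C) :
    Continuous fun x : Euc N => φ' (‖x‖ ^ 2) :=
  h.continuousOn_deriv.comp_continuous (by fun_prop) fun x => mem_Ici.mpr (sq_nonneg _)

theorem abs_mul_sq_apply_le (h : AdmissibleProfile φ φ' C) (x : Euc N) (i : Fin N) :
    |φ (‖x‖ ^ 2) * x i ^ 2| ≤ C := by
  rw [abs_mul, abs_of_nonneg (sq_nonneg (x i)), mul_comm]
  exact (mul_le_mul_of_nonneg_right (sq_apply_le_norm_sq x i) (abs_nonneg _)).trans
    (h.mul_abs_le _ (sq_nonneg _))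

theorem abs_deriv_mul_sq_apply_le (h : AdmissibleProfile φ φ' C) (x : Euc N) (i : Fin N) :
    |φ' (‖x‖ ^ 2) * x i ^ 2| ≤ C := by
  rw [abs_mul, abs_of_nonneg (sq_nonneg (x i)), mul_comm]
  exact (mul_le_mul_of_nonneg_right (sq_apply_le_norm_sq x i) (abs_nonneg _)).trans
    (h.mul_abs_deriv_le _ (sq_nonneg _))

theorem sq_mul_apply_le (h : AdmissibleProfile φ φ' C) (x : Euc N) (i : Fin N) :
    (φ (‖x‖ ^ 2) * x i) ^ 2 ≤ C ^ 2 := by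
  calc (φ (‖x‖ ^ 2) * x i) ^ 2 = φ (‖x‖ ^ 2) * (φ (‖x‖ ^ 2) * x i ^ 2) := by ring
    _ ≤ |φ (‖x‖ ^ 2)| * |φ (‖x‖ ^ 2) * x i ^ 2| := by rw [← abs_mul]; exact le_abs_self _
    _ ≤ C * C := mul_le_mul (h.abs_le _ (sq_nonneg _)) (h.abs_mul_sq_apply_le x i)
        (abs_nonneg _) ((abs_nonneg _).trans (h.abs_le 0 le_rfl))
    _ = C ^ 2 := by ring

end AdmissibleProfile

namespace MemX

variable {N : ℕ} {v : Euc N → ℝ} {φ φ' : ℝ → ℝ} {C : ℝ}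

theorem integrable_bounded_mul_sq (hv : MemX v) {q : Euc N → ℝ} (hq : Continuous q)
    (hb : ∀ x, |q x| ≤ C) : Integrable fun x => q x * v x ^ 2 * Kw x := by
  refine (hv.int_sq.bdd_mul (c := C) hq.aestronglyMeasurable (.of_forall hb)).congr
    (.of_forall fun x => ?_)
  ring

theorem integrable_gradient_apply_sq (hv : MemX v) (i : Fin N) :
    Integrable fun x => gradient v x i ^ 2 * Kw x := by
  refine hv.int_grad.mono' ?_ (.of_forall fun x => ?_)
  · exact (((measurable_gradient_apply v i).pow_const 2).mul
      continuous_Kw.measurable).aestronglyMeasurable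
  · have := Kw_pos x
    rw [Real.norm_of_nonneg (by positivity)]
    exact mul_le_mul_of_nonneg_right (sq_apply_le_norm_sq _ i) this.le

theorem integrable_cross (hv : MemX v) (h : AdmissibleProfile φ φ' C) (i : Fin N) :
    Integrable fun x => 2 * v x * gradient v x i * (φ (‖x‖ ^ 2) * x i * Kw x) := by
  have hc := h.continuous_comp (N := N)
  have hx : Continuous fun x : Euc N => x i := by fun_prop
  have hvc := hv.diff.continuous
  have hK := continuous_Kw (N := N)
  refine ((hv.integrable_gradient_apply_sq i).add (hv.int_sq.const_mul (C ^ 2))).mono' ?_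
    (.of_forall fun x => ?_)
  · have h1 : Measurable fun x : Euc N => 2 * v x := by fun_prop
    have h2 : Measurable fun x : Euc N => φ (‖x‖ ^ 2) * x i * Kw x := by
      exact ((hc.mul hx).mul hK).measurable
    exact ((h1.mul (measurable_gradient_apply v i)).mul h2).aestronglyMeasurable
  · have hKx := Kw_pos x
    have hb := h.sq_mul_apply_le x i
    have key : |2 * v x * gradient v x i * (φ (‖x‖ ^ 2) * x i)|
        ≤ gradient v x i ^ 2 + C ^ 2 * v x ^ 2 := by
      have := mul_le_mul_of_nonneg_right hb (sq_nonneg (v x))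
      rw [abs_le]
      constructor <;>
        nlinarith [sq_nonneg (gradient v x i + φ (‖x‖ ^ 2) * x i * v x),
          sq_nonneg (gradient v x i - φ (‖x‖ ^ 2) * x i * v x)]
    calc ‖2 * v x * gradient v x i * (φ (‖x‖ ^ 2) * x i * Kw x)‖
        = |2 * v x * gradient v x i * (φ (‖x‖ ^ 2) * x i)| * Kw x := by
          rw [← mul_assoc, Real.norm_eq_abs, abs_mul _ (Kw x), abs_of_pos hKx]
      _ ≤ (gradient v x i ^ 2 + C ^ 2 * v x ^ 2) * Kw x :=
          mul_le_mul_of_nonneg_right key hKx.le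
      _ = _ := by simp only [Pi.add_apply]; ring

theorem integrable_divergence (hv : MemX v) (h : AdmissibleProfile φ φ' C) (i : Fin N) :
    Integrable fun x => (φ (‖x‖ ^ 2) + 2 * φ' (‖x‖ ^ 2) * x i ^ 2 + φ (‖x‖ ^ 2) * x i ^ 2 / 2)
      * v x ^ 2 * Kw x := by
  have hc := h.continuous_comp (N := N)
  have hx : Continuous fun x : Euc N => x i := by fun_prop
  have hc' := h.continuous_deriv_comp (N := N)
  refine hv.integrable_bounded_mul_sq (C := C + 2 * C + C)
    ((hc.add ((hc'.const_mul 2).mul (hx.pow 2))).add ((hc.mul (hx.pow 2)).div_const 2)) fun x => ?_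
  have h1 := abs_le.mp (h.abs_le (‖x‖ ^ 2) (sq_nonneg _))
  have h2 := abs_le.mp (h.abs_mul_sq_apply_le x i)
  have h3 := abs_le.mp (h.abs_deriv_mul_sq_apply_le x i)
  rw [abs_le]
  constructor <;> linarith

theorem integrable_radial_sq (hv : MemX v) (h : AdmissibleProfile φ φ' C) (i : Fin N) :
    Integrable fun x => (φ (‖x‖ ^ 2) * x i) ^ 2 * v x ^ 2 * Kw x := by
  have hc := h.continuous_comp (N := N)
  have hx : Continuous fun x : Euc N => x i := by fun_prop
  refine hv.integrable_bounded_mul_sq (C := C ^ 2) ((hc.mul hx).pow 2) fun x => ?_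
  rw [abs_of_nonneg (sq_nonneg _)]
  exact h.sq_mul_apply_le x i

theorem integral_divergence_eq (hv : MemX v) (h : AdmissibleProfile φ φ' C) (i : Fin N) :
    ∫ x, (φ (‖x‖ ^ 2) + 2 * φ' (‖x‖ ^ 2) * x i ^ 2 + φ (‖x‖ ^ 2) * x i ^ 2 / 2)
      * v x ^ 2 * Kw x
      = - ∫ x, 2 * v x * gradient v x i * (φ (‖x‖ ^ 2) * x i * Kw x) := by
  have hc := h.continuous_comp (N := N)
  have hx : Continuous fun x : Euc N => x i := by fun_prop
  have hprod : Integrable fun x => v x ^ 2 * (φ (‖x‖ ^ 2) * x i * Kw x) := by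
    refine (hv.integrable_bounded_mul_sq (C := C + C) (q := fun x => φ (‖x‖ ^ 2) * x i)
      (hc.mul hx) fun x => ?_).congr (.of_forall fun x => by ring)
    have hC : 0 ≤ C := (abs_nonneg _).trans (h.abs_le 0 le_rfl)
    have := abs_le.mp (abs_le_of_sq_le_sq (h.sq_mul_apply_le x i) hC)
    rw [abs_le]; constructor <;> linarith [this.1, this.2]
  have hdiv := (hv.integrable_divergence h i).congr (g := fun x => v x ^ 2 *
    ((φ (‖x‖ ^ 2) + 2 * φ' (‖x‖ ^ 2) * x i ^ 2 + φ (‖x‖ ^ 2) * x i ^ 2 / 2) * Kw x))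
    (.of_forall fun x => by ring)
  have key := integral_bilinear_hasLineDerivAt_right_eq_neg_left_of_integrable
    (μ := (volume : Measure (Euc N)))
    (B := ContinuousLinearMap.mul ℝ ℝ) (f := fun x => v x ^ 2)
    (f' := fun x => 2 * v x * gradient v x i)
    (v := EuclideanSpace.single i (1 : ℝ))
    (g := fun y : Euc N => φ (‖y‖ ^ 2) * y i * Kw y)
    (g' := fun x => (φ (‖x‖ ^ 2) + 2 * φ' (‖x‖ ^ 2) * x i ^ 2 + φ (‖x‖ ^ 2) * x i ^ 2 / 2) * Kw x)
    (hv.integrable_cross h i) hdiv hprod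
    (fun x _ => by
      have hd := ((hv.diff x).hasFDerivAt.pow 2).hasLineDerivAt (EuclideanSpace.single i (1 : ℝ))
      convert hd using 1
      simp [fderiv_single_eq_gradient_apply])
    (fun x _ => hasLineDerivAt_weighted_radial_field h.hasDerivAt x i)
  simp only [ContinuousLinearMap.mul_apply'] at key
  rw [← key]
  exact integral_congr_ae (.of_forall fun x => by ring)

theorem integral_partial_sq_ge (hv : MemX v) (h : AdmissibleProfile φ φ' C) (i : Fin N) :
    ∫ x, ((φ (‖x‖ ^ 2) + 2 * φ' (‖x‖ ^ 2) * x i ^ 2 + φ (‖x‖ ^ 2) * x i ^ 2 / 2) * v x ^ 2 * Kw x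
      - (φ (‖x‖ ^ 2) * x i) ^ 2 * v x ^ 2 * Kw x)
      ≤ ∫ x, gradient v x i ^ 2 * Kw x := by
  have hnn : 0 ≤ ∫ x, (gradient v x i ^ 2 * Kw x
      + 2 * v x * gradient v x i * (φ (‖x‖ ^ 2) * x i * Kw x)
      + (φ (‖x‖ ^ 2) * x i) ^ 2 * v x ^ 2 * Kw x) := by
    refine integral_nonneg fun x => ?_
    have : 0 ≤ (gradient v x i + φ (‖x‖ ^ 2) * x i * v x) ^ 2 * Kw x :=
      mul_nonneg (sq_nonneg _) (Kw_pos x).le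
    refine this.trans_eq ?_
    ring
  rw [integral_add (f := fun x => gradient v x i ^ 2 * Kw x
      + 2 * v x * gradient v x i * (φ (‖x‖ ^ 2) * x i * Kw x)) ((hv.integrable_gradient_apply_sq i).add (hv.integrable_cross h i))
      (hv.integrable_radial_sq h i),
    integral_add (hv.integrable_gradient_apply_sq i) (hv.integrable_cross h i)] at hnn
  rw [integral_sub (hv.integrable_divergence h i) (hv.integrable_radial_sq h i),
    hv.integral_divergence_eq h i]
  linarith

/-- Weighted Hardy inequality obtained by testing against the field `φ(|x|²) x`. -/
theorem integral_profile_le_gradNormSq (hv : MemX v) (h : AdmissibleProfile φ φ' C) :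
    Integrable (fun x => (N * φ (‖x‖ ^ 2) + 2 * φ' (‖x‖ ^ 2) * ‖x‖ ^ 2
      + φ (‖x‖ ^ 2) * ‖x‖ ^ 2 / 2 - φ (‖x‖ ^ 2) ^ 2 * ‖x‖ ^ 2) * v x ^ 2 * Kw x) ∧
    ∫ x, (N * φ (‖x‖ ^ 2) + 2 * φ' (‖x‖ ^ 2) * ‖x‖ ^ 2
      + φ (‖x‖ ^ 2) * ‖x‖ ^ 2 / 2 - φ (‖x‖ ^ 2) ^ 2 * ‖x‖ ^ 2) * v x ^ 2 * Kw x
      ≤ gradNormSq v := by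
  have hsum := Finset.sum_le_sum fun i (_ : i ∈ Finset.univ) => hv.integral_partial_sq_ge h i
  have hint (i : Fin N) : Integrable fun x =>
      (φ (‖x‖ ^ 2) + 2 * φ' (‖x‖ ^ 2) * x i ^ 2 + φ (‖x‖ ^ 2) * x i ^ 2 / 2) * v x ^ 2 * Kw x
      - (φ (‖x‖ ^ 2) * x i) ^ 2 * v x ^ 2 * Kw x := (hv.integrable_divergence h i).sub (hv.integrable_radial_sq h i)
  rw [← integral_finsetSum _ fun i _ => hint i,
    ← integral_finsetSum _ fun i _ => hv.integrable_gradient_apply_sq i] at hsum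
  have hL : (fun x => ∑ i : Fin N,
      ((φ (‖x‖ ^ 2) + 2 * φ' (‖x‖ ^ 2) * x i ^ 2 + φ (‖x‖ ^ 2) * x i ^ 2 / 2) * v x ^ 2 * Kw x
      - (φ (‖x‖ ^ 2) * x i) ^ 2 * v x ^ 2 * Kw x)) =
      fun x => (N * φ (‖x‖ ^ 2) + 2 * φ' (‖x‖ ^ 2) * ‖x‖ ^ 2
      + φ (‖x‖ ^ 2) * ‖x‖ ^ 2 / 2 - φ (‖x‖ ^ 2) ^ 2 * ‖x‖ ^ 2) * v x ^ 2 * Kw x := by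
    funext x
    set s := ‖x‖ ^ 2 with hs
    have hs' : s = ∑ i, x i ^ 2 := by rw [hs, EuclideanSpace.real_norm_sq_eq]
    simp only [Finset.sum_sub_distrib, ← Finset.sum_mul, Finset.sum_add_distrib, mul_pow,
      ← Finset.mul_sum, ← Finset.sum_div, ← hs']
    simp
    ring
  have hR : (fun x => ∑ i : Fin N, gradient v x i ^ 2 * Kw x)
      = fun x => ‖gradient v x‖ ^ 2 * Kw x := by
    funext x
    rw [← Finset.sum_mul, ← EuclideanSpace.real_norm_sq_eq]
  rw [hR, hL] at hsum
  refine ⟨?_, hsum⟩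
  rw [← hL]
  exact integrable_finsetSum _ fun i _ => hint i

end MemX

/-- The field realising both the Hardy term and the spectral-gap term, regularised at the origin. -/
theorem admissibleProfile_hardy {a ε : ℝ} (ha : 0 ≤ a) (hε : 0 < ε) :
    AdmissibleProfile (fun s => a / (s + ε) + 2 / (8 + s))
      (fun s => -a / (s + ε) ^ 2 - 2 / (8 + s) ^ 2) (a + a / ε + 2) where
  hasDerivAt s hs := by
    have h1 := ((hasDerivAt_id s).add_const ε).fun_inv (by simp only [id]; positivity)
    have h2 := ((hasDerivAt_id s).const_add 8).fun_inv (by simp only [id]; positivity)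
    refine ((h1.const_mul a).add (h2.const_mul 2)).congr_deriv ?_
    simp only [id]
    ring
  continuousOn_deriv := by
    refine .sub (.div (by fun_prop) (by fun_prop) fun s hs => ?_)
      (.div (by fun_prop) (by fun_prop) fun s hs => ?_) <;>
    · have : (0 : ℝ) ≤ s := hs
      positivity
  abs_le s hs := by
    rw [abs_of_nonneg (by positivity)]
    have h1 : a / (s + ε) ≤ a / ε := by gcongr; linarith
    have h2 : 2 / (8 + s) ≤ 2 := by rw [div_le_iff₀ (by positivity)]; nlinarith
    linarith
  mul_abs_le s hs := by
    rw [abs_of_nonneg (by positivity)]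
    have h1 : s * (a / (s + ε)) ≤ a := by
      rw [mul_div_assoc', div_le_iff₀ (by positivity)]; nlinarith
    have h2 : s * (2 / (8 + s)) ≤ 2 := by
      rw [mul_div_assoc', div_le_iff₀ (by positivity)]; nlinarith
    have h3 : 0 ≤ a / ε := by positivity
    linarith
  mul_abs_deriv_le s hs := by
    have h0 : |-a / (s + ε) ^ 2 - 2 / (8 + s) ^ 2| = a / (s + ε) ^ 2 + 2 / (8 + s) ^ 2 := by
      rw [abs_of_nonpos, neg_sub, neg_div]
      · ring
      · have : 0 ≤ a / (s + ε) ^ 2 := by positivity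
        have : 0 ≤ 2 / (8 + s) ^ 2 := by positivity
        rw [neg_div]; linarith
    rw [h0]
    have h1 : s * (a / (s + ε) ^ 2) ≤ a / ε := by
      rw [mul_div_assoc', div_le_div_iff₀ (by positivity) hε]
      nlinarith [mul_nonneg ha (sq_nonneg s), mul_nonneg ha (sq_nonneg ε),
        mul_nonneg ha (mul_nonneg hs hε.le)]
    have h2 : s * (2 / (8 + s) ^ 2) ≤ 2 := by
      rw [mul_div_assoc', div_le_iff₀ (by positivity)]; nlinarith
    linarith

theorem hardy_profile_lower_bound {a ε s : ℝ} (ha : 0 ≤ a) (hε : 0 < ε) (hs : 0 ≤ s) :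
    s / (s + ε) * (a ^ 2 / s + a / 2 + 1 / 4) ≤
      (2 * a + 2) * (a / (s + ε) + 2 / (8 + s))
        + 2 * (-a / (s + ε) ^ 2 - 2 / (8 + s) ^ 2) * s
        + (a / (s + ε) + 2 / (8 + s)) * s / 2 - (a / (s + ε) + 2 / (8 + s)) ^ 2 * s := by
  set P := (s + ε)⁻¹ with hP
  set R := (8 + s)⁻¹ with hR
  have hP0 : 0 ≤ P := by positivity
  have hR0 : 0 ≤ R := by positivity
  have hPs : P * s ≤ 1 := by
    rw [hP, inv_mul_le_iff₀ (by positivity)]; linarith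
  have hRs : R * (8 + s) = 1 := inv_mul_cancel₀ (by positivity)
  have hsing : s / (s + ε) * (a ^ 2 / s) ≤ a ^ 2 * P := by
    rcases hs.eq_or_lt with rfl | hs
    · simp; positivity
    · apply le_of_eq; rw [hP]; field_simp
  have hgap : 1 / 4 ≤ 4 * R - 8 * R ^ 2 * s + R * s := by
    have : 4 * R - 8 * R ^ 2 * s + R * s = R ^ 2 * (32 + 4 * s + s ^ 2) := by
      linear_combination (-(4 * R) - R * s) * hRs
    have h4 : 1 / 4 = R ^ 2 * ((8 + s) ^ 2 / 4) := by
      linear_combination (-(1 / 4) * (R * (8 + s) + 1)) * hRs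
    rw [this, h4]
    gcongr
    nlinarith
  have hcross : 0 ≤ 4 * a * R * (1 - P * s) := by
    have := sub_nonneg.mpr hPs
    positivity
  have hhardy : 0 ≤ a * P * (a + 2) * (1 - P * s) := by
    have := sub_nonneg.mpr hPs
    positivity
  have hquarter : s / (s + ε) * (1 / 4) ≤ 1 / 4 := by
    rw [div_eq_inv_mul, ← hP]; linarith
  have hL : s / (s + ε) * (a ^ 2 / s + a / 2 + 1 / 4) =
      s / (s + ε) * (a ^ 2 / s) + a / 2 * (P * s) + s / (s + ε) * (1 / 4) := by
    rw [hP]; ring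
  have hQ : (2 * a + 2) * (a / (s + ε) + 2 / (8 + s))
        + 2 * (-a / (s + ε) ^ 2 - 2 / (8 + s) ^ 2) * s
        + (a / (s + ε) + 2 / (8 + s)) * s / 2 - (a / (s + ε) + 2 / (8 + s)) ^ 2 * s
      = a ^ 2 * P + a / 2 * (P * s) + a * P * (a + 2) * (1 - P * s)
        + 4 * a * R * (1 - P * s) + (4 * R - 8 * R ^ 2 * s + R * s) := by
    simp only [div_eq_mul_inv, ← hP, ← hR]
    rw [← inv_pow, ← inv_pow, ← hP, ← hR]
    ring
  rw [hL, hQ]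
  linarith

namespace MemX

variable {N : ℕ} {v : Euc N → ℝ}

theorem integrable_hardy_weight (hv : MemX v) (c d : ℝ) :
    Integrable fun x => (c / ‖x‖ ^ 2 + d) * v x ^ 2 * Kw x := by
  refine ((hv.int_hardy.const_mul c).add (hv.int_sq.const_mul d)).congr (.of_forall fun x => ?_)
  simp only [Pi.add_apply]
  ring

theorem hardy_inequality (hN : 3 ≤ N) (hv : MemX v) :
    ∫ x, ((((N : ℝ) - 2) / 2) ^ 2 / ‖x‖ ^ 2 + (((N : ℝ) - 2) / 4 + 1 / 4)) * v x ^ 2 * Kw x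
      ≤ gradNormSq v := by
  have hN' : (3 : ℝ) ≤ N := by exact_mod_cast hN
  have : Nonempty (Fin N) := ⟨⟨0, by lia⟩⟩
  obtain ⟨a, ha⟩ : ∃ a : ℝ, a = ((N : ℝ) - 2) / 2 := ⟨_, rfl⟩
  have ha0 : 0 ≤ a := by rw [ha]; linarith
  have hNa : (N : ℝ) = 2 * a + 2 := by rw [ha]; ring
  rw [show ((N : ℝ) - 2) / 4 = a / 2 by rw [ha]; ring, ← ha]
  have hg := hv.integrable_hardy_weight (a ^ 2) (a / 2 + 1 / 4)
  set g : Euc N → ℝ := fun x => (a ^ 2 / ‖x‖ ^ 2 + (a / 2 + 1 / 4)) * v x ^ 2 * Kw x with hgdef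
  have hτ : ∀ (n : ℕ) (x : Euc N), 0 ≤ ‖x‖ ^ 2 / (‖x‖ ^ 2 + 1 / ((n : ℝ) + 1)) ∧
      ‖x‖ ^ 2 / (‖x‖ ^ 2 + 1 / ((n : ℝ) + 1)) ≤ 1 := fun n x => by
    have hε : (0 : ℝ) < 1 / (n + 1) := by positivity
    exact ⟨by positivity, by rw [div_le_one (by positivity)]; linarith⟩
  have hτm (n : ℕ) : Continuous fun x : Euc N => ‖x‖ ^ 2 / (‖x‖ ^ 2 + 1 / ((n : ℝ) + 1)) :=
    .div (by fun_prop) (by fun_prop) fun x => by positivity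
  have hτg (n : ℕ) : Integrable fun x => ‖x‖ ^ 2 / (‖x‖ ^ 2 + 1 / ((n : ℝ) + 1)) * g x :=
    hg.bdd_mul (c := 1) (hτm n).aestronglyMeasurable
      (.of_forall fun x => by rw [Real.norm_of_nonneg (hτ n x).1]; exact (hτ n x).2)
  have hlim : Filter.Tendsto
      (fun n : ℕ => ∫ x, ‖x‖ ^ 2 / (‖x‖ ^ 2 + 1 / ((n : ℝ) + 1)) * g x) Filter.atTop
      (nhds (∫ x, g x)) := by
    refine tendsto_integral_of_dominated_convergence (fun x => ‖g x‖)
      (fun n => (hτg n).aestronglyMeasurable) hg.norm (fun n => .of_forall fun x => ?_) ?_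
    · rw [norm_mul, Real.norm_of_nonneg (hτ n x).1]
      exact mul_le_of_le_one_left (norm_nonneg _) (hτ n x).2
    · filter_upwards [Measure.ae_ne volume (0 : Euc N)] with x hx
      have hx2 : ‖x‖ ^ 2 ≠ 0 := by positivity
      have h1 := (tendsto_const_nhds (x := ‖x‖ ^ 2)).div
        ((tendsto_one_div_add_atTop_nhds_zero_nat (𝕜 := ℝ)).const_add (‖x‖ ^ 2)) (by simpa using hx)
      simpa [div_self hx2] using h1.mul_const (g x)
  refine le_of_tendsto' hlim fun n => ?_
  have hε : (0 : ℝ) < 1 / (n + 1) := by positivity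
  obtain ⟨hint, hle⟩ := hv.integral_profile_le_gradNormSq (admissibleProfile_hardy ha0 hε)
  refine (integral_mono (hτg n) hint fun x => ?_).trans hle
  have hb := hardy_profile_lower_bound ha0 hε (sq_nonneg ‖x‖)
  have hw : 0 ≤ v x ^ 2 * Kw x := mul_nonneg (sq_nonneg _) (Kw_pos x).le
  have := mul_le_mul_of_nonneg_right hb hw
  rw [← hNa] at this
  simp only [hgdef]
  linarith

theorem Afun_eq (hv : MemX v) (μ : ℝ) :
    Afun μ v = gradNormSq v - ∫ x, (μ / ‖x‖ ^ 2 + ((N : ℝ) - 2) / 4) * v x ^ 2 * Kw x := by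
  rw [gradNormSq, ← integral_sub hv.int_grad (hv.integrable_hardy_weight _ _), Afun]
  exact integral_congr_ae (.of_forall fun x => by ring)

theorem quarter_normKsq_le_Afun (hN : 3 ≤ N) {μ : ℝ} (hμ : μ ≤ ((N : ℝ) - 2) ^ 2 / 8)
    (hv : MemX v) : 1 / 4 * normKsq v ≤ Afun μ v := by
  have hH := hv.hardy_inequality hN
  have hμ' : μ ≤ (((N : ℝ) - 2) / 2) ^ 2 := by nlinarith [sq_nonneg ((N : ℝ) - 2)]
  have hle : ∫ x, ((μ / ‖x‖ ^ 2 + ((N : ℝ) - 2) / 4) * v x ^ 2 * Kw x + 1 / 4 * (v x ^ 2 * Kw x)) ≤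
      ∫ x, ((((N : ℝ) - 2) / 2) ^ 2 / ‖x‖ ^ 2 + (((N : ℝ) - 2) / 4 + 1 / 4)) * v x ^ 2 * Kw x := by
    refine integral_mono ((hv.integrable_hardy_weight _ _).add (hv.int_sq.const_mul _))
      (hv.integrable_hardy_weight _ _) fun x => ?_
    have hw : 0 ≤ v x ^ 2 * Kw x := mul_nonneg (sq_nonneg _) (Kw_pos x).le
    have : μ / ‖x‖ ^ 2 ≤ (((N : ℝ) - 2) / 2) ^ 2 / ‖x‖ ^ 2 := by gcongr
    have := mul_le_mul_of_nonneg_right this hw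
    simp only
    linarith
  rw [integral_add (hv.integrable_hardy_weight _ _) (hv.int_sq.const_mul _),
    integral_const_mul] at hle
  rw [hv.Afun_eq, normKsq]
  linarith

end MemX

theorem normKsq_nonneg {N : ℕ} (v : Euc N → ℝ) : 0 ≤ normKsq v :=
  integral_nonneg fun x => mul_nonneg (sq_nonneg _) (Kw_pos x).le

/-- if (8(p+1)/(p−1))E_K(v₀) ≤ ‖v₀‖²_{K,2} < ((p−1)/(2(p+1)))‖v₀‖^{p+1}_{K,p+1},
then D_K(v₀) < 0 and ‖v₀‖_{K,2} dominates the L²_K norm of every v ∈ 𝒩 with E_K(v) < E_K(v₀);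
in particular ‖v₀‖_{K,2} ≥ Λ_{E_K(v₀)}. Here p+1 = 2* = twoStar N and B(v₀) = ‖v₀‖^{p+1}_{K,p+1}. -/
theorem blowup_initial_data_conditions (N : ℕ) (hN : 3 ≤ N) (μ : ℝ)
    (hμ : μ ∈ Set.Icc (0 : ℝ) (((N : ℝ) - 2) ^ 2 / 8))
    (v₀ : Euc N → ℝ) (hv₀ : MemX v₀)
    (h1 : 8 * twoStar N / (twoStar N - 2) * EKf μ v₀ ≤ normKsq v₀)
    (h2 : normKsq v₀ < (twoStar N - 2) / (2 * twoStar N) * Bfun v₀) :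
    DK μ v₀ < 0 ∧
    (∀ v : Euc N → ℝ, MemX v → v ≠ 0 → DK μ v = 0 → EKf μ v < EKf μ v₀ →
      Real.sqrt (normKsq v) ≤ Real.sqrt (normKsq v₀)) ∧
    sSup { r : ℝ | ∃ v : Euc N → ℝ, MemX v ∧ v ≠ 0 ∧ DK μ v = 0 ∧
      EKf μ v < EKf μ v₀ ∧ r = Real.sqrt (normKsq v) } ≤ Real.sqrt (normKsq v₀) := by
  have hN' : (3 : ℝ) ≤ N := by exact_mod_cast hN
  have hN2 : (N : ℝ) - 2 ≠ 0 := by linarith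
  have hN0 : (N : ℝ) ≠ 0 := by linarith
  have hM0 := normKsq_nonneg v₀
  have hcoef : twoStar N - 2 = 4 / ((N : ℝ) - 2) := by
    rw [twoStar]; field_simp; ring
  have hE (v : Euc N → ℝ) :
      N * EKf μ v = N / 2 * Afun μ v - ((N : ℝ) - 2) / 2 * Bfun v := by
    rw [EKf, twoStar]; field_simp
  rw [show 8 * twoStar N / (twoStar N - 2) = 4 * N by
    rw [hcoef, twoStar]; field_simp; ring] at h1
  rw [show (twoStar N - 2) / (2 * twoStar N) = 1 / N by
    rw [hcoef, twoStar]; field_simp; ring] at h2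
  rw [div_mul_eq_mul_div, lt_div_iff₀ (by linarith), one_mul] at h2
  have hmono (v : Euc N → ℝ) (hv : MemX v) (_ : v ≠ 0) (hD : DK μ v = 0)
      (hlt : EKf μ v < EKf μ v₀) : √(normKsq v) ≤ √(normKsq v₀) := by
    have hA := hv.quarter_normKsq_le_Afun hN hμ.2
    have hEv := hE v
    have hB : Bfun v = Afun μ v := by rw [DK] at hD; linarith
    have hEA : N * EKf μ v = Afun μ v := by rw [hEv, hB]; ring
    have := mul_lt_mul_of_pos_left hlt (show (0 : ℝ) < N by linarith)
    exact Real.sqrt_le_sqrt (by linarith)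
  refine ⟨?_, hmono, Real.sSup_le ?_ (Real.sqrt_nonneg _)⟩
  · have := hE v₀
    rw [DK]
    nlinarith
  · rintro r ⟨v, hv, hv0, hD, hlt, rfl⟩
    exact hmono v hv hv0 hD hlt
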